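/- arXiv:1707.08734 — 3 statements merged into one kernel-verified Lean document; each statement's English description precedes it below -/
import Mathlib

section
/- Let G be a subset of the set of agents A with |G| ≥ 3. Then any two call sequences are ∼_G-equivalent: for all call sequences σ and τ, σ ∼_G τ. In particular every call sequence is ∼_G-equivalent to the empty sequence ε. -/
namespace Gossip

/-- A call between two distinct agents. -/
structure Call (A : Type) where
  x : A
  y : A
  ne : x ≠ y

variable {A : Type} [DecidableEq A]

/-- Agent `a` is involved in the call `c`. -/
def Call.involves (c : Call A) (a : A) : Prop := a = c.x ∨ a = c.y

instance (c : Call A) (a : A) : Decidable (c.involves a) := by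
  unfold Call.involves; infer_instance

/-- `c` is the call between agents `a` and `b`. -/
def Call.isBetween (c : Call A) (a b : A) : Prop :=
  (c.x = a ∧ c.y = b) ∨ (c.x = b ∧ c.y = a)

instance (c : Call A) (a b : A) : Decidable (c.isBetween a b) := by
  unfold Call.isBetween; infer_instance

/-- The effect of a call on a gossip situation: the two agents involved
pool their secrets. -/
def Call.apply (c : Call A) (s : A → Finset A) : A → Finset A :=
  fun d => if d = c.x ∨ d = c.y then s c.x ∪ s c.y else s d

/-- The initial gossip situation: each agent is familiar only with their
own secret (secrets are identified with agents via the fixed bijection). -/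
def root : A → Finset A := fun a => {a}

/-- The result of applying a call sequence to a gossip situation. -/
def applySeq (σ : List (Call A)) (s : A → Finset A) : A → Finset A :=
  σ.foldl (fun t c => c.apply t) s

/-- `∼_a` : the smallest relation with `ε ∼_a ε`, closed under appending
calls not involving `a` on either side, and under appending a call
involving `a` on both sides when it yields the same set of secrets for `a`. -/
inductive AgEquiv (a : A) : List (Call A) → List (Call A) → Prop
  | nil : AgEquiv a [] []
  | extLeft {σ τ : List (Call A)} (c : Call A) :
      ¬ c.involves a → AgEquiv a σ τ → AgEquiv a (σ ++ [c]) τ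
  | extRight {σ τ : List (Call A)} (c : Call A) :
      ¬ c.involves a → AgEquiv a σ τ → AgEquiv a σ (τ ++ [c])
  | call {σ τ : List (Call A)} (c : Call A) :
      c.involves a →
      applySeq (σ ++ [c]) root a = applySeq (τ ++ [c]) root a →
      AgEquiv a σ τ → AgEquiv a (σ ++ [c]) (τ ++ [c])

/-- `∼_G` : reflexive-transitive closure of the union of the `∼_a`, `a ∈ G`. -/
def GEquiv (G : Finset A) : List (Call A) → List (Call A) → Prop :=
  Relation.ReflTransGen (fun σ τ => ∃ a ∈ G, AgEquiv a σ τ)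

/-- Formulas of the language `L^ck`. `fam a p` is `F_a p`,
`ck G φ` is `C_G φ`; `K_a φ` is `ck {a} φ`. -/
inductive Formula (A : Type) where
  | fam : A → A → Formula A
  | neg : Formula A → Formula A
  | conj : Formula A → Formula A → Formula A
  | ck : Finset A → Formula A → Formula A

/-- Truth of a formula at a call sequence (in the gossip model). -/
def Sat : Formula A → List (Call A) → Prop
  | .fam a p, σ => p ∈ applySeq σ root a
  | .neg φ, σ => ¬ Sat φ σ
  | .conj φ ψ, σ => Sat φ σ ∧ Sat ψ σ
  | .ck G φ, σ => ∀ τ, GEquiv G σ τ → Sat φ τ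

/-- `M ⊨ φ` : truth at every call sequence. -/
def Truth (φ : Formula A) : Prop := ∀ σ : List (Call A), Sat φ σ

/-- Formulas with no occurrence of the negation symbol. -/
def NegFree : Formula A → Prop
  | .fam _ _ => True
  | .neg _ => False
  | .conj φ ψ => NegFree φ ∧ NegFree ψ
  | .ck _ φ => NegFree φ

/-- Formulas with no occurrence of the `C_G` modalities (propositional part). -/
def CkFree : Formula A → Prop
  | .fam _ _ => True
  | .neg φ => CkFree φ
  | .conj φ ψ => CkFree φ ∧ CkFree ψ
  | .ck _ _ => False

/-- Formulas of `L_wn`: no nested occurrence of the `C_G` modalities. -/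
def NoNested : Formula A → Prop
  | .fam _ _ => True
  | .neg φ => NoNested φ
  | .conj φ ψ => NoNested φ ∧ NoNested ψ
  | .ck _ φ => CkFree φ

/-- The call `ab` occurs in `σ`. -/
def occursBetween (a b : A) (σ : List (Call A)) : Prop :=
  ∃ c ∈ σ, c.isBetween a b

/-- Epistemic pair-view component `Ṽ(σ)(a,b)`. -/
def pairView (σ : List (Call A)) (a b : A) : Set (A → Finset A) :=
  {s | ∃ τ, GEquiv {a, b} σ τ ∧ s = applySeq τ root}

/-- The full epistemic pair-view `Ṽ(σ)` : all components `Ṽ(σ)(a,b)`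
together with the designated situation `Ṽ(σ)(*) = σ(root)`. -/
def fullView (σ : List (Call A)) : (A → A → Set (A → Finset A)) × (A → Finset A) :=
  (pairView σ, applySeq σ root)

/-- A call sequence is pair-epistemically non-redundant if no nonempty
subsequence `σ₂` of a prefix `σ₁.σ₂` is pair-epistemically redundant. -/
def PairNonRedundant (σ : List (Call A)) : Prop :=
  ∀ σ₁ σ₂ : List (Call A), (σ₁ ++ σ₂) <+: σ → σ₂ ≠ [] →
    fullView σ₁ ≠ fullView (σ₁ ++ σ₂)

/-- Order on gossip situations: componentwise inclusion. -/
def gsLE (s t : A → Finset A) : Prop := ∀ a, s a ⊆ t a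

/-- The order `≤_EPV` on (the pair components of) epistemic pair-views. -/
def epvLE (V W : A → A → Set (A → Finset A)) : Prop :=
  ∀ a b : A, ∃ X : Set (A → Finset A), X ⊆ V a b ∧
    ∃ g : X → W a b, Function.Surjective g ∧ ∀ s : X, gsLE s.1 (g s).1

/-- `σ` is ab-redundant free: no call of `σ` different from the call `ab`
is redundant (leaves the current gossip situation unchanged). -/
def abRedundantFree (a b : A) (σ : List (Call A)) : Prop :=
  ∀ (i : ℕ) (h : i < σ.length), ¬ (σ.get ⟨i, h⟩).isBetween a b →
    (σ.get ⟨i, h⟩).apply (applySeq (σ.take i) root) ≠ applySeq (σ.take i) root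

theorem Call.exists_mem_not_involves (c : Call A) {G : Finset A} (hG : 3 ≤ G.card) :
    ∃ a ∈ G, ¬ c.involves a := by
  obtain ⟨a, ha, hac⟩ := Finset.exists_mem_notMem_of_card_lt_card
    (s := {c.x, c.y}) (t := G) (Finset.card_le_two.trans_lt hG)
  exact ⟨a, ha, by simpa [Call.involves] using hac⟩

theorem AgEquiv.refl (a : A) (σ : List (Call A)) : AgEquiv a σ σ := by
  induction σ using List.reverseRecOn with
  | nil => exact .nil
  | append_singleton σ c ih =>
    by_cases h : c.involves a
    · exact .call c h rfl ih
    · exact .extLeft c h (.extRight c h ih)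

theorem AgEquiv.symm {a : A} {σ τ : List (Call A)} (h : AgEquiv a σ τ) : AgEquiv a τ σ := by
  induction h with
  | nil => exact .nil
  | extLeft c hc _ ih => exact .extRight c hc ih
  | extRight c hc _ ih => exact .extLeft c hc ih
  | call c hc he _ ih => exact .call c hc he.symm ih

theorem GEquiv.symm {G : Finset A} {σ τ : List (Call A)} (h : GEquiv G σ τ) : GEquiv G τ σ := by
  induction h with
  | refl => exact .refl
  | tail _ h ih =>
    obtain ⟨a, ha, h⟩ := h
    exact .head ⟨a, ha, h.symm⟩ ih

theorem gEquiv_nil {G : Finset A} (hG : 3 ≤ G.card) (σ : List (Call A)) : GEquiv G σ [] := by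
  induction σ using List.reverseRecOn with
  | nil => exact .refl
  | append_singleton σ c ih =>
    obtain ⟨a, ha, hc⟩ := c.exists_mem_not_involves hG
    exact .head ⟨a, ha, .extLeft c hc (.refl a σ)⟩ ih

theorem stmt1 {A : Type} [DecidableEq A] [Fintype A] (hA : 3 ≤ Fintype.card A)
    (G : Finset A) (hG : 3 ≤ G.card) :
    (∀ σ τ : List (Call A), GEquiv G σ τ) ∧
      (∀ σ : List (Call A), GEquiv G σ []) := by
  exact ⟨fun σ τ => (gEquiv_nil hG σ).trans (gEquiv_nil hG τ).symm, gEquiv_nil hG⟩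

end Gossip
end

section
/- Let a and b be two distinct agents. For every call sequence σ in which the call ab does not occur, σ is related to the empty sequence ε by the composition ∼_a ∘ ∼_b ∘ ∼_a ∘ ∼_b; that is, there exist call sequences τ₁, τ₂, τ₃ with σ ∼_a τ₁, τ₁ ∼_b τ₂, τ₂ ∼_a τ₃ and τ₃ ∼_b ε. -/
namespace Gossip

variable {A : Type} [DecidableEq A]

theorem Call.involves_iff_of_isBetween {A : Type} {c : Call A} {a y : A} (h : c.isBetween a y) (e : A) :
    c.involves e ↔ e = a ∨ e = y := by
  rcases h with ⟨rfl, rfl⟩ | ⟨rfl, rfl⟩ <;> simp [Call.involves, or_comm]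

theorem Call.apply_of_isBetween {c : Call A} {a y : A} (h : c.isBetween a y)
    (s : A → Finset A) (e : A) :
    c.apply s e = if e = a ∨ e = y then s a ∪ s y else s e := by
  rcases h with ⟨rfl, rfl⟩ | ⟨rfl, rfl⟩
  · rfl
  · simp [Call.apply, or_comm, Finset.union_comm]

theorem Call.exists_isBetween {A : Type} {c : Call A} {a : A} (h : c.involves a) :
    ∃ y, y ≠ a ∧ c.isBetween a y := by
  rcases h with rfl | rfl
  · exact ⟨c.y, c.ne.symm, Or.inl ⟨rfl, rfl⟩⟩
  · exact ⟨c.x, c.ne, Or.inr ⟨rfl, rfl⟩⟩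

theorem Call.apply_of_not_involves {c : Call A} {a : A} (h : ¬ c.involves a)
    (s : A → Finset A) : c.apply s a = s a :=
  if_neg h

theorem applySeq_append (σ τ : List (Call A)) (s : A → Finset A) :
    applySeq (σ ++ τ) s = applySeq τ (applySeq σ s) :=
  List.foldl_append

theorem applySeq_concat (σ : List (Call A)) (c : Call A) (s : A → Finset A) :
    applySeq (σ ++ [c]) s = c.apply (applySeq σ s) :=
  applySeq_append σ [c] s

theorem mem_applySeq_root (σ : List (Call A)) (e : A) : e ∈ applySeq σ root e := by
  induction σ using List.reverseRecOn with
  | nil => simp [applySeq, root]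
  | append_singleton σ c ih =>
    rw [applySeq_concat]
    unfold Call.apply
    split_ifs with h
    · rcases h with rfl | rfl
      · exact Finset.mem_union_left _ ih
      · exact Finset.mem_union_right _ ih
    · exact ih

theorem AgEquiv.append_right {a : A} {σ τ : List (Call A)} (h : AgEquiv a σ τ)
    (ρ : List (Call A)) (hρ : ∀ c ∈ ρ, ¬ c.involves a) : AgEquiv a σ (τ ++ ρ) := by
  induction ρ using List.reverseRecOn with
  | nil => simpa using h
  | append_singleton ρ c ih =>
    rw [← List.append_assoc]
    exact .extRight c (hρ c (by simp)) (ih fun d hd => hρ d (by simp [hd]))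

theorem AgEquiv.append_left {a : A} {σ τ : List (Call A)} (h : AgEquiv a σ τ)
    (ρ : List (Call A)) (hρ : ∀ c ∈ ρ, ¬ c.involves a) : AgEquiv a (σ ++ ρ) τ := by
  induction ρ using List.reverseRecOn with
  | nil => simpa using h
  | append_singleton ρ c ih =>
    rw [← List.append_assoc]
    exact .extLeft c (hρ c (by simp)) (ih fun d hd => hρ d (by simp [hd]))

/-- The sequence `ρ`, executed in the situation `s`, teaches `y` exactly the secrets in `N`,
using only agents in `N` and `y` itself. -/
structure Feeds (s : A → Finset A) (y : A) (N : Finset A) (ρ : List (Call A)) : Prop where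
  target : applySeq ρ s y = s y ∪ N
  outside : ∀ e, e ≠ y → e ∉ N → applySeq ρ s e = s e
  inside : ∀ e ∈ N, applySeq ρ s e ⊆ s y ∪ N
  involved : ∀ c ∈ ρ, ∀ e, c.involves e → e = y ∨ e ∈ N

theorem Feeds.concat {s : A → Finset A} {y : A} {N : Finset A} {ρ : List (Call A)}
    (h : Feeds s y N ρ) {e : A} (hey : e ≠ y) (heN : e ∉ N) (hse : s e = {e}) :
    Feeds s y (insert e N) (ρ ++ [⟨e, y, hey⟩]) := by
  have hc : (⟨e, y, hey⟩ : Call A).isBetween e y := Or.inl ⟨rfl, rfl⟩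
  have hU : applySeq ρ s e ∪ applySeq ρ s y = s y ∪ insert e N := by
    rw [h.target, h.outside e hey heN, hse]
    rw [Finset.insert_eq, Finset.union_left_comm]
  refine ⟨?_, fun x hxy hxN => ?_, fun x hx => ?_, fun c hcm x hx => ?_⟩
  · rw [applySeq_concat, Call.apply_of_isBetween hc, if_pos (Or.inr rfl), hU]
  · rw [Finset.mem_insert, not_or] at hxN
    rw [applySeq_concat, Call.apply_of_isBetween hc, if_neg (by tauto),
      h.outside x hxy hxN.2]
  · rw [applySeq_concat, Call.apply_of_isBetween hc]
    split_ifs with hxe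
    · exact hU.subset
    · have hxN : x ∈ N := by
        rw [Finset.mem_insert] at hx
        tauto
      exact (h.inside x hxN).trans
        (Finset.union_subset_union_right (Finset.subset_insert e N))
  · rw [List.mem_append, List.mem_singleton] at hcm
    rw [Finset.mem_insert]
    rcases hcm with hcm | rfl
    · have := h.involved c hcm x hx
      tauto
    · have := (Call.involves_iff_of_isBetween hc x).1 hx
      tauto

theorem exists_feeds (s : A → Finset A) (y : A) (N : Finset A) (hy : y ∉ N)
    (hs : ∀ e ∈ N, s e = {e}) : ∃ ρ, Feeds s y N ρ := by
  induction N using Finset.induction_on with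
  | empty => exact ⟨[], by simp [applySeq], by simp [applySeq], by simp, by simp⟩
  | insert e N heN ih =>
    rw [Finset.mem_insert, not_or] at hy
    obtain ⟨ρ, hρ⟩ := ih hy.2 fun x hx => hs x (Finset.mem_insert_of_mem hx)
    exact ⟨_, hρ.concat (Ne.symm hy.1) heN (hs e (Finset.mem_insert_self e N))⟩

/-- All calls of `τ` except one do not involve `b`, and the exceptional one does not involve `a`. -/
def SingleContact {A : Type} (a b : A) (τ : List (Call A)) : Prop :=
  ∃ (τ₀ : List (Call A)) (c : Call A) (ρ : List (Call A)), τ = τ₀ ++ [c] ++ ρ ∧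
    ¬ c.involves a ∧ (∀ d ∈ τ₀, ¬ d.involves b) ∧ (∀ d ∈ ρ, ¬ d.involves b)

theorem SingleContact.append {A : Type} {a b : A} {τ : List (Call A)} (h : SingleContact a b τ)
    {ρ : List (Call A)} (hρ : ∀ d ∈ ρ, ¬ d.involves b) : SingleContact a b (τ ++ ρ) := by
  obtain ⟨τ₀, c, ρ₀, rfl, hc, h₀, h₁⟩ := h
  refine ⟨τ₀, c, ρ₀ ++ ρ, by simp, hc, h₀, fun d hd => ?_⟩
  rcases List.mem_append.1 hd with hd | hd
  exacts [h₁ d hd, hρ d hd]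

/-- If `ab` does not occur in `σ`, then the view of `a` is realised by a sequence in which
agents whose secret is unknown to `a` know only their own secret, and in which `b` makes no
call as long as `a` does not learn the secret of `b`, and a single call otherwise. -/
theorem exists_lazy_realization {a b : A} (hab : a ≠ b) (σ : List (Call A))
    (h : ¬ occursBetween a b σ) :
    ∃ τ, AgEquiv a σ τ ∧ applySeq τ root a = applySeq σ root a ∧
      (∀ e ∉ applySeq σ root a, applySeq τ root e = {e}) ∧
      (∀ e ∈ applySeq σ root a, applySeq τ root e ⊆ applySeq σ root a) ∧
      (b ∉ applySeq σ root a → ∀ d ∈ τ, ¬ d.involves b) ∧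
      (b ∈ applySeq σ root a → SingleContact a b τ) := by
  induction σ using List.reverseRecOn with
  | nil =>
    refine ⟨[], .nil, rfl, fun _ _ => rfl, fun e he => ?_, by simp, fun hb => ?_⟩
    · obtain rfl : e = a := by simpa [applySeq, root] using he
      exact subset_rfl
    · exact absurd (by simpa [applySeq, root] using hb : b = a) hab.symm
  | append_singleton σ c ih =>
    obtain ⟨τ, hστ, hτa, hout, hin, hb₀, hb₁⟩ :=
      ih fun ⟨d, hd, hd'⟩ => h ⟨d, by simp [hd], hd'⟩
    by_cases hca : c.involves a
    swap
    · have hσ : applySeq (σ ++ [c]) root a = applySeq σ root a := by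
        rw [applySeq_concat, Call.apply_of_not_involves hca]
      rw [hσ]
      exact ⟨τ, .extLeft c hca hστ, hτa, hout, hin, hb₀, hb₁⟩
    obtain ⟨y, hya, hc⟩ := Call.exists_isBetween hca
    have hyb : y ≠ b := by
      rintro rfl
      exact h ⟨c, by simp, hc⟩
    set Q := applySeq σ root a with hQ
    set s := applySeq τ root with hs
    set Q' := applySeq (σ ++ [c]) root a with hQ'
    have hQ'eq : Q' = Q ∪ applySeq σ root y := by
      rw [hQ', applySeq_concat, Call.apply_of_isBetween hc, if_pos (Or.inl rfl)]
    have hQQ' : Q ⊆ Q' := hQ'eq ▸ Finset.subset_union_left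
    have hyQ' : y ∈ Q' := hQ'eq ▸ Finset.mem_union_right _ (mem_applySeq_root σ y)
    have haQ : a ∈ Q := mem_applySeq_root σ a
    have hys : y ∈ s y := mem_applySeq_root τ y
    have hsy : s y ⊆ Q' := by
      by_cases hyQ : y ∈ Q
      · exact (hin y hyQ).trans hQQ'
      · rw [hout y hyQ]
        exact Finset.singleton_subset_iff.2 hyQ'
    set N := (Q' \ Q).erase y with hN
    have memN : ∀ e, e ∈ N ↔ e ≠ y ∧ e ∈ Q' ∧ e ∉ Q := by
      intro e
      simp [hN]
    have hNs : ∀ e ∈ N, s e = {e} := fun e he => hout e ((memN e).1 he).2.2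
    have hyN : y ∉ N := by simp [memN]
    have haN : a ∉ N := by simp [memN, haQ]
    have hcb : ¬ c.involves b := by
      rw [Call.involves_iff_of_isBetween hc]
      rintro (rfl | rfl)
      exacts [hab rfl, hyb rfl]
    obtain ⟨ρ, hρ, hρ₀, hρ₁⟩ : ∃ ρ, Feeds s y N ρ ∧ (b ∉ N → ∀ d ∈ ρ, ¬ d.involves b) ∧
        (b ∈ N → SingleContact a b (τ ++ ρ)) := by
      by_cases hbN : b ∈ N
      · obtain ⟨ρ, hρ⟩ := exists_feeds s y (N.erase b) (fun hy => hyN (Finset.mem_of_mem_erase hy))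
          fun e he => hNs e (Finset.mem_of_mem_erase he)
        have hρ' := hρ.concat (Ne.symm hyb) (by simp) (hNs b hbN)
        rw [Finset.insert_erase hbN] at hρ'
        refine ⟨_, hρ', fun hb => absurd hbN hb, fun _ =>
          ⟨τ ++ ρ, ⟨b, y, hyb.symm⟩, [], by simp, ?_, fun d hd hdb => ?_, by simp⟩⟩
        · rintro (h₁ | h₁)
          exacts [hab h₁, hya h₁.symm]
        · rcases List.mem_append.1 hd with hd | hd
          · exact hb₀ ((memN b).1 hbN).2.2 d hd hdb
          · rcases hρ.involved d hd b hdb with h₁ | h₁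
            · exact hyb h₁.symm
            · simp at h₁
      · obtain ⟨ρ, hρ⟩ := exists_feeds s y N hyN hNs
        refine ⟨ρ, hρ, fun _ d hd hdb => ?_, fun hb => absurd hb hbN⟩
        rcases hρ.involved d hd b hdb with h₁ | h₁
        exacts [hyb h₁.symm, hbN h₁]
    have hρa : ∀ d ∈ ρ, ¬ d.involves a := fun d hd hda => by
      rcases hρ.involved d hd a hda with h₁ | h₁
      exacts [hya h₁.symm, haN h₁]
    have hU : applySeq (τ ++ ρ) root a ∪ applySeq (τ ++ ρ) root y = Q' := by
      rw [applySeq_append, ← hs, hρ.target, hρ.outside a hya.symm haN, hτa]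
      ext x
      simp only [Finset.mem_union, memN]
      constructor
      · rintro (h₁ | h₁ | h₁)
        exacts [hQQ' h₁, hsy h₁, h₁.2.1]
      · intro h₁
        by_cases hxy : x = y
        · exact Or.inr (Or.inl (hxy ▸ hys))
        · by_cases hxQ : x ∈ Q
          · exact Or.inl hxQ
          · exact Or.inr (Or.inr ⟨hxy, h₁, hxQ⟩)
    have happ : ∀ e, applySeq (τ ++ ρ ++ [c]) root e =
        if e = a ∨ e = y then Q' else applySeq ρ s e := by
      intro e
      rw [applySeq_concat, Call.apply_of_isBetween hc, hU, applySeq_append]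
    have happa : applySeq (τ ++ ρ ++ [c]) root a = Q' := by
      rw [happ, if_pos (Or.inl rfl)]
    refine ⟨τ ++ ρ ++ [c], .call c hca happa.symm (hστ.append_right ρ hρa), happa,
      fun e he => ?_, fun e he => ?_, fun hb d hd => ?_, fun hb => ?_⟩
    · have hey : e ≠ y := fun h₁ => he (h₁ ▸ hyQ')
      have heQ : e ∉ Q := fun h₁ => he (hQQ' h₁)
      have hea : e ≠ a := fun h₁ => heQ (h₁ ▸ haQ)
      rw [happ, if_neg (not_or.2 ⟨hea, hey⟩),
        hρ.outside e hey (fun h₁ => he ((memN e).1 h₁).2.1), hout e heQ]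
    · rw [happ]
      split_ifs with hay
      · exact subset_rfl
      · rw [not_or] at hay
        by_cases heN : e ∈ N
        · exact (hρ.inside e heN).trans
            (Finset.union_subset hsy fun x hx => ((memN x).1 hx).2.1)
        · rw [hρ.outside e hay.2 heN]
          have heQ : e ∈ Q := by
            by_contra heQ
            exact heN ((memN e).2 ⟨hay.2, he, heQ⟩)
          exact (hin e heQ).trans hQQ'
    · have hbQ : b ∉ Q := fun h₁ => hb (hQQ' h₁)
      have hbN : b ∉ N := fun h₁ => hb ((memN b).1 h₁).2.1
      simp only [List.mem_append, List.mem_singleton] at hd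
      rcases hd with (hd | hd) | rfl
      exacts [hb₀ hbQ d hd, hρ₀ hbN d hd, hcb]
    · have hcs : ∀ d ∈ [c], ¬ d.involves b := by simpa using hcb
      refine SingleContact.append ?_ hcs
      by_cases hbQ : b ∈ Q
      · exact (hb₁ hbQ).append (hρ₀ (by simp [memN, hbQ]))
      · exact hρ₁ ((memN b).2 ⟨hyb.symm, hb, hbQ⟩)

theorem stmt6 {A : Type} [DecidableEq A] [Fintype A] (hA : 3 ≤ Fintype.card A)
    (a b : A) (hab : a ≠ b) (σ : List (Call A)) (h : ¬ occursBetween a b σ) :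
    ∃ τ₁ τ₂ τ₃ : List (Call A),
      AgEquiv a σ τ₁ ∧ AgEquiv b τ₁ τ₂ ∧ AgEquiv a τ₂ τ₃ ∧ AgEquiv b τ₃ [] := by
  obtain ⟨τ, hστ, -, -, -, hb₀, hb₁⟩ := exists_lazy_realization hab σ h
  by_cases hb : b ∈ applySeq σ root a
  · obtain ⟨τ₀, c, ρ, rfl, hc, hτ₀, hρ⟩ := hb₁ hb
    exact ⟨_, τ₀ ++ [c], τ₀, hστ, (AgEquiv.refl b _).append_left ρ hρ,
      (AgEquiv.refl a τ₀).extLeft c hc, by simpa using AgEquiv.nil.append_left τ₀ hτ₀⟩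
  · exact ⟨τ, [], [], hστ, by simpa using AgEquiv.nil.append_left τ (hb₀ hb), .nil, .nil⟩

end Gossip
end

section
/- Let a, b, c be three pairwise distinct agents and let σ be the call sequence (ac, bc, ac). Then (M, σ) ⊨ K_a K_b K_a F_c A, (M, σ) ⊨ K_a K_b F_c A, (M, σ) ⊨ K_a F_c A, but (M, σ) ⊭ C_{ab} F_c A, where F_c A states that agent c is familiar with the secret of agent a. (Hence common knowledge of two agents is not equivalent to 3-fold or shorter iterated knowledge.) -/
namespace Gossip

variable {A : Type} [DecidableEq A]

@[simp] theorem applySeq_nil (s : A → Finset A) : applySeq [] s = s := rfl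

@[simp] theorem applySeq_cons (k : Call A) (σ : List (Call A)) (s : A → Finset A) :
    applySeq (k :: σ) s = applySeq σ (k.apply s) := rfl

theorem Call.subset_apply (k : Call A) (s : A → Finset A) (d : A) : s d ⊆ k.apply s d := by
  unfold Call.apply
  split_ifs with h
  · rcases h with rfl | rfl
    · exact Finset.subset_union_left
    · exact Finset.subset_union_right
  · exact subset_rfl

theorem subset_applySeq (σ : List (Call A)) (s : A → Finset A) (d : A) :
    s d ⊆ applySeq σ s d := by
  induction σ generalizing s with
  | nil => exact subset_rfl
  | cons k σ ih => exact (k.subset_apply s d).trans (ih _)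

theorem self_mem_applySeq (σ : List (Call A)) (d : A) : d ∈ applySeq σ root d :=
  subset_applySeq σ root d (by simp [root])

theorem applySeq_eq_of_not_involves {σ : List (Call A)} {d : A}
    (h : ∀ k ∈ σ, ¬ k.involves d) (s : A → Finset A) : applySeq σ s d = s d := by
  induction σ generalizing s with
  | nil => rfl
  | cons k σ ih =>
    rw [applySeq_cons, ih fun l hl => h l (List.mem_cons_of_mem _ hl)]
    exact if_neg (h k List.mem_cons_self)

/-- An agent knows the secrets of both participants of every call it took part in. -/
theorem mem_applySeq_of_involves {σ : List (Call A)} {k : Call A} {d : A} (hk : k ∈ σ)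
    (hd : k.involves d) {s : A → Finset A} (hs : ∀ e, e ∈ s e) :
    k.x ∈ applySeq σ s d ∧ k.y ∈ applySeq σ s d := by
  induction σ generalizing s with
  | nil => simp at hk
  | cons l σ ih =>
    rcases List.mem_cons.1 hk with rfl | hk
    · have h : k.apply s d = s k.x ∪ s k.y := if_pos hd
      rw [applySeq_cons]
      exact ⟨subset_applySeq σ _ d (by simp [h, hs]), subset_applySeq σ _ d (by simp [h, hs])⟩
    · exact ih hk fun e => l.subset_apply s e (hs e)

/-- The calls involving `a` in a call sequence, each paired with the secrets that `a` is
familiar with right after the call. -/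
def view (a : A) : List (Call A) → (A → Finset A) → List (Call A × Finset A)
  | [], _ => []
  | k :: σ, s =>
    if k.involves a then (k, k.apply s a) :: view a σ (k.apply s) else view a σ (k.apply s)

theorem view_append (a : A) (σ τ : List (Call A)) (s : A → Finset A) :
    view a (σ ++ τ) s = view a σ s ++ view a τ (applySeq σ s) := by
  induction σ generalizing s with
  | nil => rfl
  | cons k σ ih =>
    simp only [List.cons_append, view, applySeq_cons, ih]
    split_ifs <;> rfl

theorem view_eq_nil {a : A} {σ : List (Call A)} (h : ∀ k ∈ σ, ¬ k.involves a)
    (s : A → Finset A) : view a σ s = [] := by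
  induction σ generalizing s with
  | nil => rfl
  | cons k σ ih =>
    simp only [view, if_neg (h k List.mem_cons_self)]
    exact ih (fun l hl => h l (List.mem_cons_of_mem _ hl)) _

theorem exists_of_view_eq_cons {a : A} {σ : List (Call A)} {s : A → Finset A} {k : Call A}
    {S : Finset A} {L : List (Call A × Finset A)} (h : view a σ s = (k, S) :: L) :
    ∃ σ₁ σ₂, σ = σ₁ ++ k :: σ₂ ∧ k.involves a ∧ (∀ l ∈ σ₁, ¬ l.involves a) ∧
      k.apply (applySeq σ₁ s) a = S ∧ view a σ₂ (k.apply (applySeq σ₁ s)) = L := by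
  induction σ generalizing s with
  | nil => simp [view] at h
  | cons l σ ih =>
    by_cases hl : l.involves a
    · simp only [view, if_pos hl, List.cons.injEq, Prod.mk.injEq] at h
      obtain ⟨⟨rfl, rfl⟩, rfl⟩ := h
      exact ⟨[], σ, rfl, hl, by simp, rfl, rfl⟩
    · simp only [view, if_neg hl] at h
      obtain ⟨σ₁, σ₂, rfl, hk, hσ₁, hS, hL⟩ := ih h
      exact ⟨l :: σ₁, σ₂, rfl, hk, by simpa [hl] using hσ₁, hS, hL⟩

theorem mem_map_fst_view {a : A} {σ : List (Call A)} {s : A → Finset A} {k : Call A} :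
    k ∈ (view a σ s).map Prod.fst ↔ k ∈ σ ∧ k.involves a := by
  induction σ generalizing s with
  | nil => simp [view]
  | cons l σ ih =>
    by_cases hl : l.involves a
    · rw [view, if_pos hl, List.map_cons, List.mem_cons, ih, List.mem_cons]
      constructor
      · rintro (rfl | h)
        · exact ⟨Or.inl rfl, hl⟩
        · exact ⟨Or.inr h.1, h.2⟩
      · rintro ⟨h | h, h'⟩
        · exact Or.inl h
        · exact Or.inr ⟨h, h'⟩
    · rw [view, if_neg hl, ih, List.mem_cons]
      constructor
      · exact fun h => ⟨Or.inr h.1, h.2⟩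
      · rintro ⟨rfl | h, h'⟩
        · exact absurd h' hl
        · exact ⟨h, h'⟩

theorem AgEquiv.view_eq {a : A} {σ τ : List (Call A)} (h : AgEquiv a σ τ) :
    view a σ root = view a τ root := by
  induction h with
  | nil => rfl
  | extLeft k hk _ ih => simp [view_append, view, hk, ih]
  | extRight k hk _ ih => simp [view_append, view, hk, ih]
  | call k hk heq _ ih =>
    simp only [applySeq_append, applySeq_cons, applySeq_nil] at heq
    simp [view_append, view, hk, ih, heq]

theorem GEquiv.view_eq {a : A} {σ τ : List (Call A)} (h : GEquiv {a} σ τ) :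
    view a σ root = view a τ root := by
  induction h with
  | refl => rfl
  | tail _ h ih =>
    obtain ⟨d, hd, h⟩ := h
    obtain rfl := Finset.mem_singleton.1 hd
    exact ih.trans h.view_eq

/-- A sequence that `a` cannot distinguish from one in which `a` and `c` called each other
makes `c` familiar with the secret of `a`. -/
theorem mem_of_mem_of_isBetween {a c : A} {σ τ : List (Call A)} {k : Call A} (hk : k ∈ σ)
    (hkac : k.isBetween a c) (h : GEquiv {a} σ τ) : a ∈ applySeq τ root c := by
  have ha : k.involves a := by rcases hkac with h | h <;> simp [Call.involves, h]
  have hc : k.involves c := by rcases hkac with h | h <;> simp [Call.involves, h]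
  have hkτ : k ∈ τ :=
    (mem_map_fst_view.1 (h.view_eq ▸ mem_map_fst_view.2 ⟨hk, ha⟩)).1
  have := mem_applySeq_of_involves hkτ hc (s := root) (by simp [root])
  rcases hkac with h | h
  · exact h.1 ▸ this.1
  · exact h.2 ▸ this.2

theorem Call.isBetween_of_involves {k : Call A} {a b c : A} (hc : k.involves c)
    (ha : ¬ k.involves a) (hx : k.x ∈ ({a, b, c} : Finset A))
    (hy : k.y ∈ ({a, b, c} : Finset A)) : k.isBetween b c := by
  have := k.ne
  simp only [Finset.mem_insert, Finset.mem_singleton] at hx hy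
  unfold Call.involves at hc ha
  unfold Call.isBetween
  grind

theorem Call.apply_of_isBetween_s9 {k : Call A} {b c : A} (h : k.isBetween b c)
    (s : A → Finset A) : k.apply s b = s b ∪ s c ∧ k.apply s c = s b ∪ s c := by
  rcases h with ⟨rfl, rfl⟩ | ⟨rfl, rfl⟩ <;> simp [Call.apply, Finset.union_comm]

theorem exists_first_involves {σ : List (Call A)} {d : A} (h : ∃ k ∈ σ, k.involves d) :
    ∃ σ₁ k σ₂, σ = σ₁ ++ k :: σ₂ ∧ k.involves d ∧ ∀ l ∈ σ₁, ¬ l.involves d := by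
  induction σ with
  | nil => simp at h
  | cons l σ ih =>
    by_cases hl : l.involves d
    · exact ⟨[], l, σ, rfl, hl, by simp⟩
    · obtain ⟨σ₁, k, σ₂, rfl, hk, hσ₁⟩ := ih (by simpa [hl] using h)
      exact ⟨l :: σ₁, k, σ₂, rfl, hk, by simpa [hl] using hσ₁⟩

/-- If `a` calls `c` twice, learning only the secret of `c` the first time and only that of
`b` the second time, then the first call of `b` is one with `c` in which `b` learns exactly
the secrets of `a` and `c`. -/
theorem view_eq_cons_of_view_eq {a b c : A} (hab : a ≠ b) (hac : a ≠ c) (hbc : b ≠ c)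
    {τ : List (Call A)}
    (h : view a τ root = [(⟨a, c, hac⟩, {a, c}), (⟨a, c, hac⟩, {a, b, c})]) :
    ∃ k L, k.isBetween b c ∧ view b τ root = (k, {a, b, c}) :: L := by
  obtain ⟨X, τ, rfl, -, hX, hS₁, h⟩ := exists_of_view_eq_cons h
  obtain ⟨Y, Z, rfl, -, hY, hS₂, -⟩ := exists_of_view_eq_cons h
  have hac' : (⟨a, c, hac⟩ : Call A).isBetween a c := Or.inl ⟨rfl, rfl⟩
  have hXc : ∀ k ∈ X, ¬ k.involves c := by
    intro k hk hkc
    have hm := mem_applySeq_of_involves hk hkc (s := root) (by simp [root])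
    rw [(Call.apply_of_isBetween_s9 hac' _).1] at hS₁
    have hsub : applySeq X root c ⊆ {a, c} := hS₁ ▸ Finset.subset_union_right
    have hx := hsub hm.1
    have hy := hsub hm.2
    have := hX k hk
    have := k.ne
    simp only [Finset.mem_insert, Finset.mem_singleton] at hx hy
    unfold Call.involves at *
    grind
  set s₁ := Call.apply ⟨a, c, hac⟩ (applySeq X root) with hs₁
  have hs₁a : s₁ a = {a, c} := hS₁
  have hs₁c : s₁ c = {a, c} := by
    rw [← hS₁, hs₁, (Call.apply_of_isBetween_s9 hac' _).1, (Call.apply_of_isBetween_s9 hac' _).2]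
  have hself : ∀ e, e ∈ s₁ e := fun e => Call.subset_apply _ _ e (self_mem_applySeq X e)
  rw [(Call.apply_of_isBetween_s9 hac' _).1, applySeq_eq_of_not_involves hY, hs₁a] at hS₂
  have hsub : applySeq Y s₁ c ⊆ {a, b, c} := hS₂ ▸ Finset.subset_union_right
  have hYc : ∃ k ∈ Y, k.involves c := by
    by_contra! hcon
    rw [applySeq_eq_of_not_involves hcon, hs₁c, Finset.union_self] at hS₂
    have : b ∈ ({a, c} : Finset A) := hS₂ ▸ by simp
    simp [hab.symm, hbc] at this
  obtain ⟨Y₁, k, Y₂, rfl, hkc, hY₁⟩ := exists_first_involves hYc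
  have hk : k ∈ Y₁ ++ k :: Y₂ := by simp
  have hm := mem_applySeq_of_involves hk hkc hself
  have hkbc : k.isBetween b c :=
    Call.isBetween_of_involves hkc (hY k hk) (hsub hm.1) (hsub hm.2)
  have hkb : k.involves b := by rcases hkbc with h | h <;> simp [Call.involves, h]
  set W := X ++ ⟨a, c, hac⟩ :: Y₁ with hW
  have hWs : applySeq W root = applySeq Y₁ s₁ := by
    rw [hW, applySeq_append, applySeq_cons]
  have hWc : applySeq W root c = {a, c} := by
    rw [hWs, applySeq_eq_of_not_involves hY₁, hs₁c]
  have hWb : applySeq W root b ⊆ {a, b, c} := by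
    refine subset_trans ?_ hsub
    rw [applySeq_append Y₁, applySeq_cons, ← hWs]
    refine subset_trans ?_ (subset_applySeq Y₂ _ c)
    rw [(Call.apply_of_isBetween_s9 hkbc _).2]
    exact Finset.subset_union_left
  have hWnb : ∀ l ∈ W, ¬ l.involves b := by
    intro l hl hlb
    have hm := mem_applySeq_of_involves hl hlb (s := root) (by simp [root])
    have hx := hWb hm.1
    have hy := hWb hm.2
    have hne := l.ne
    simp only [Finset.mem_insert, Finset.mem_singleton] at hx hy
    rw [hW, List.mem_append, List.mem_cons] at hl
    rcases hl with hl | rfl | hl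
    · have h₁ := hX l hl
      have h₂ := hXc l hl
      unfold Call.involves at *
      grind
    · rcases hlb with h | h
      · exact hab h.symm
      · exact hbc h
    · have h₁ := hY l (by simp [hl])
      have h₂ := hY₁ l hl
      unfold Call.involves at *
      grind
  have heq : X ++ ⟨a, c, hac⟩ :: (Y₁ ++ k :: Y₂ ++ ⟨a, c, hac⟩ :: Z) =
      W ++ k :: (Y₂ ++ ⟨a, c, hac⟩ :: Z) := by simp [hW]
  have hres : k.apply (applySeq W root) b = {a, b, c} := by
    rw [(Call.apply_of_isBetween_s9 hkbc _).1, hWc, applySeq_eq_of_not_involves hWnb]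
    ext d
    simp only [root, Finset.mem_union, Finset.mem_insert, Finset.mem_singleton]
    tauto
  refine ⟨k, view b (Y₂ ++ ⟨a, c, hac⟩ :: Z) (k.apply (applySeq W root)), hkbc, ?_⟩
  rw [heq, view_append, view_eq_nil hWnb, List.nil_append, view, if_pos hkb, hres]

/-- If the first call of `b` is one with `c` in which `b` learns exactly the secrets of `a`
and `c`, then `a` and `c` have called each other. -/
theorem exists_isBetween_of_view_eq_cons {a b c : A} (hab : a ≠ b) (hac : a ≠ c)
    {τ : List (Call A)} {k : Call A} {L : List (Call A × Finset A)} (hk : k.isBetween b c)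
    (h : view b τ root = (k, {a, b, c}) :: L) : ∃ l ∈ τ, l.isBetween a c := by
  obtain ⟨τ₁, τ₂, rfl, -, hτ₁, hS, -⟩ := exists_of_view_eq_cons h
  rw [(Call.apply_of_isBetween_s9 hk _).1, applySeq_eq_of_not_involves hτ₁] at hS
  have hsub : applySeq τ₁ root c ⊆ {a, b, c} := hS ▸ Finset.subset_union_right
  have ha : a ∈ applySeq τ₁ root c := by
    have : a ∈ root b ∪ applySeq τ₁ root c := hS ▸ by simp
    simpa [root, hab] using this
  have hc : ∃ l ∈ τ₁, l.involves c := by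
    by_contra! hcon
    rw [applySeq_eq_of_not_involves hcon] at ha
    simp [root, hac] at ha
  obtain ⟨l, hl, hlc⟩ := hc
  have hm := mem_applySeq_of_involves hl hlc (s := root) (by simp [root])
  rw [Finset.insert_comm] at hsub
  exact ⟨l, by simp [hl],
    Call.isBetween_of_involves hlc (hτ₁ l hl) (hsub hm.1) (hsub hm.2)⟩

theorem stmt9 {A : Type} [DecidableEq A] [Fintype A] (hA : 3 ≤ Fintype.card A)
    (a b c : A) (hab : a ≠ b) (hac : a ≠ c) (hbc : b ≠ c) :
    Sat (Formula.ck {a} (Formula.ck {b} (Formula.ck {a} (Formula.fam c a))))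
      [⟨a, c, hac⟩, ⟨b, c, hbc⟩, ⟨a, c, hac⟩] ∧
    Sat (Formula.ck {a} (Formula.ck {b} (Formula.fam c a)))
      [⟨a, c, hac⟩, ⟨b, c, hbc⟩, ⟨a, c, hac⟩] ∧
    Sat (Formula.ck {a} (Formula.fam c a))
      [⟨a, c, hac⟩, ⟨b, c, hbc⟩, ⟨a, c, hac⟩] ∧
    ¬ Sat (Formula.ck {a, b} (Formula.fam c a))
      [⟨a, c, hac⟩, ⟨b, c, hbc⟩, ⟨a, c, hac⟩] := by
  have hview : view a [⟨a, c, hac⟩, ⟨b, c, hbc⟩, ⟨a, c, hac⟩] root =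
      [(⟨a, c, hac⟩, {a, c}), (⟨a, c, hac⟩, {a, b, c})] := by
    have h₁ : ({a} ∪ {c} : Finset A) = {a, c} := rfl
    simp [view, Call.involves, Call.apply, root, hab, hab.symm, hac, hbc, hbc.symm, h₁,
      Finset.insert_comm b a]
  have main : Sat (Formula.ck {a} (Formula.ck {b} (Formula.ck {a} (Formula.fam c a))))
      [⟨a, c, hac⟩, ⟨b, c, hbc⟩, ⟨a, c, hac⟩] := by
    intro τ₁ h₁ τ₂ h₂ τ₃ h₃
    obtain ⟨k, L, hk, hL⟩ :=
      view_eq_cons_of_view_eq hab hac hbc (h₁.view_eq.symm.trans hview)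
    obtain ⟨l, hl, hlac⟩ :=
      exists_isBetween_of_view_eq_cons hab hac hk (h₂.view_eq.symm.trans hL)
    exact mem_of_mem_of_isBetween hl hlac h₃
  refine ⟨main, fun τ₁ h₁ τ₂ h₂ => main τ₁ h₁ τ₂ h₂ τ₂ .refl,
    fun τ₁ h₁ => main τ₁ h₁ τ₁ .refl τ₁ .refl, fun hcon => ?_⟩
  have hb : ¬ (⟨a, c, hac⟩ : Call A).involves b := by
    simp [Call.involves, hab.symm, hbc]
  have ha : ¬ (⟨b, c, hbc⟩ : Call A).involves a := by simp [Call.involves, hab, hac]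
  have hchain : GEquiv {a, b} [⟨a, c, hac⟩, ⟨b, c, hbc⟩, ⟨a, c, hac⟩] [] :=
    .head ⟨b, by simp, .extLeft (σ := [_, _]) _ hb (.refl b [⟨a, c, hac⟩, ⟨b, c, hbc⟩])⟩ <|
    .head ⟨a, by simp, .extLeft (σ := [_]) _ ha (.refl a [⟨a, c, hac⟩])⟩ <|
    .single ⟨b, by simp, .extLeft (σ := []) _ hb .nil⟩
  have : a ∈ root c := hcon [] hchain
  simp [root, hac] at this

end Gossip
end
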